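/- Let q be a nonzero real number, let α > 0, and let f : ℝ → ℝ be twice differentiable on a neighborhood of α with f'(α) ≠ 0 and f''(α) ≠ 0, and set g(t) = f(t^(1/q)) for t > 0 and μ_q(α^q) = g''(α^q)/(1 + g'(α^q)²)^(3/2). Then |μ_q(α^q)| ≤ |f''(α)| / ((q·α^(q-1))²·(1 + (f'(α)/(q·α^(q-1)))²)^(3/2)) holds if and only if |1 + (f'(α)/f''(α))·(1-q)/α| ≤ 1 (equivalently, 0 ≤ (f'(α)/f''(α))·(q-1)/α ≤ 2). -/

import Mathlib

open Real

/-- First derivative of `t ↦ f (t ^ p)` at a point `t > 0`. -/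
theorem deriv_comp_rpow {f : ℝ → ℝ} {p t : ℝ} (ht : 0 < t)
    (hf : DifferentiableAt ℝ f (t ^ p)) :
    deriv (fun t : ℝ => f (t ^ p)) t = deriv f (t ^ p) * (p * t ^ (p - 1)) :=
  (hf.hasDerivAt.comp t (Real.hasDerivAt_rpow_const (Or.inl ht.ne'))).deriv

/-- Second derivative of `t ↦ f (t ^ p)` at a point `t > 0`. -/
theorem deriv_deriv_comp_rpow {f : ℝ → ℝ} {p t : ℝ} (ht : 0 < t)
    (hf : ∀ᶠ y in nhds (t ^ p), DifferentiableAt ℝ f y)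
    (hf2 : DifferentiableAt ℝ (deriv f) (t ^ p)) :
    deriv (deriv (fun t : ℝ => f (t ^ p))) t =
      deriv (deriv f) (t ^ p) * (p * t ^ (p - 1)) ^ 2 +
        deriv f (t ^ p) * (p * ((p - 1) * t ^ (p - 1 - 1))) := by
  have hcont : ContinuousAt (fun t : ℝ => t ^ p) t :=
    Real.continuousAt_rpow_const t p (Or.inl ht.ne')
  have heq : deriv (fun t : ℝ => f (t ^ p)) =ᶠ[nhds t]
      fun t => deriv f (t ^ p) * (p * t ^ (p - 1)) := by
    filter_upwards [hcont.eventually hf, lt_mem_nhds ht] with u hu hu0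
    exact deriv_comp_rpow hu0 hu
  rw [heq.deriv_eq]
  have h1 : HasDerivAt (fun t : ℝ => deriv f (t ^ p))
      (deriv (deriv f) (t ^ p) * (p * t ^ (p - 1))) t :=
    HasDerivAt.comp t (h₂ := deriv f) (h := fun t : ℝ => t ^ p) hf2.hasDerivAt
      (Real.hasDerivAt_rpow_const (Or.inl ht.ne'))
  have h2 : HasDerivAt (fun t : ℝ => p * t ^ (p - 1))
      (p * ((p - 1) * t ^ (p - 1 - 1))) t :=
    (Real.hasDerivAt_rpow_const (Or.inl ht.ne')).const_mul p
  rw [(h1.fun_mul h2).deriv]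
  ring

/-- Theorem 4.7: the curvature bound
`|μ_q(α^q)| ≤ |f''(α)| / ((q·α^(q-1))²·(1 + (f'(α)/(q·α^(q-1)))²)^(3/2))` holds iff
`|1 + (f'(α)/f''(α))·(1-q)/α| ≤ 1`, equivalently
`0 ≤ (f'(α)/f''(α))·(q-1)/α ≤ 2`, where `g(t) = f(t^(1/q))` and
`μ_q(α^q) = g''(α^q)/(1 + g'(α^q)²)^(3/2)`. -/
theorem curvature_bound_comparison (q α : ℝ) (hq : q ≠ 0) (hα : 0 < α)
    (f : ℝ → ℝ) (s : Set ℝ) (hs : s ∈ nhds α)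
    (hf : ∀ y ∈ s, DifferentiableAt ℝ f y)
    (hf2 : ∀ y ∈ s, DifferentiableAt ℝ (deriv f) y)
    (hf' : deriv f α ≠ 0) (hf'' : deriv (deriv f) α ≠ 0) :
    (|deriv (deriv (fun t : ℝ => f (t ^ (1 / q)))) (α ^ q) /
          (1 + (deriv (fun t : ℝ => f (t ^ (1 / q))) (α ^ q)) ^ 2) ^ ((3 : ℝ) / 2)| ≤
        |deriv (deriv f) α| /
          ((q * α ^ (q - 1)) ^ 2 *
            (1 + (deriv f α / (q * α ^ (q - 1))) ^ 2) ^ ((3 : ℝ) / 2)) ↔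
      |1 + deriv f α / deriv (deriv f) α * ((1 - q) / α)| ≤ 1) ∧
    (|1 + deriv f α / deriv (deriv f) α * ((1 - q) / α)| ≤ 1 ↔
      0 ≤ deriv f α / deriv (deriv f) α * ((q - 1) / α) ∧
        deriv f α / deriv (deriv f) α * ((q - 1) / α) ≤ 2) := by
  have hA : 0 < α ^ q := Real.rpow_pos_of_pos hα q
  have hroot : (α ^ q) ^ (1 / q) = α := by
    rw [← Real.rpow_mul hα.le, mul_one_div_cancel hq, Real.rpow_one]
  have hfα : DifferentiableAt ℝ f α := hf α (mem_of_mem_nhds hs)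
  have hf2α : DifferentiableAt ℝ (deriv f) α := hf2 α (mem_of_mem_nhds hs)
  have hD : q * α ^ (q - 1) ≠ 0 := mul_ne_zero hq (Real.rpow_pos_of_pos hα _).ne'
  have hg1 : deriv (fun t : ℝ => f (t ^ (1 / q))) (α ^ q) =
      deriv f α / (q * α ^ (q - 1)) := by
    rw [deriv_comp_rpow hA (by rwa [hroot]), Real.rpow_sub_one hA.ne', hroot,
      Real.rpow_sub_one hα.ne']
    field_simp
  have hg2 : deriv (deriv (fun t : ℝ => f (t ^ (1 / q)))) (α ^ q) =
      deriv (deriv f) α / (q * α ^ (q - 1)) ^ 2 *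
        (1 + deriv f α / deriv (deriv f) α * ((1 - q) / α)) := by
    rw [deriv_deriv_comp_rpow hA (by rw [hroot]; exact Filter.mem_of_superset hs hf)
      (by rwa [hroot]), Real.rpow_sub_one hA.ne', Real.rpow_sub_one hA.ne',
      Real.rpow_sub_one hA.ne', hroot, Real.rpow_sub_one hα.ne']
    field_simp
  have hneg : deriv f α / deriv (deriv f) α * ((1 - q) / α) =
      -(deriv f α / deriv (deriv f) α * ((q - 1) / α)) := by ring
  refine ⟨?_, ?_⟩
  · rw [hg1, hg2]
    set R := (1 + (deriv f α / (q * α ^ (q - 1))) ^ 2) ^ ((3 : ℝ) / 2) with hR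
    have hRpos : 0 < R := Real.rpow_pos_of_pos (by positivity) _
    have hpos : 0 < |deriv (deriv f) α| / ((q * α ^ (q - 1)) ^ 2 * R) := by positivity
    rw [abs_div, abs_mul, abs_div, abs_of_pos hRpos, abs_of_nonneg (sq_nonneg (q * α ^ (q - 1))),
      mul_div_right_comm, div_div, mul_le_iff_le_one_right hpos]
  · rw [hneg, abs_le]
    constructor <;> rintro ⟨h1, h2⟩ <;> constructor <;> linarith
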